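/- Let K : ℕ → ℕ satisfy 1 ≤ K(n) and n − K(n) = Ω(n), and fix ε < 10^{−9}. Let τ₂ be the minimum t such that every vertex of [n] is incident to at least 2 edges among those presented during the first t rounds of the K-choice process. Then for every online algorithm that selects at most (1 + ε)·n edges during the first τ₂ rounds, the probability that its graph B_{τ₂} is Hamiltonian is bounded away from 1: there exists δ > 0 such that for all sufficiently large n, Pr(B_{τ₂} is Hamiltonian) ≤ 1 − δ. -/

import Mathlib

open Filter

namespace KChoiceAdaptive

/-- The non-diagonal edges of the complete graph on `Fin n`. -/
def allEdges (n : ℕ) : Finset (Sym2 (Fin n)) :=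
  Finset.univ.filter fun e => ¬ e.IsDiag

/-- An online algorithm: given the history of presented sets of edges
(most recent round first), it selects at most one edge. -/
def Alg (n : ℕ) := List (Finset (Sym2 (Fin n))) → Option (Sym2 (Fin n))

/-- The set of edges selected by the algorithm `A` along a history of presented
sets (most recent round first); a selection only counts if it is one of the edges
presented at that round. -/
def selEdges (n : ℕ) (A : Alg n) : List (Finset (Sym2 (Fin n))) → Finset (Sym2 (Fin n))
  | [] => ∅
  | F :: rest =>
      match A (F :: rest) with
      | some e => if e ∈ F then insert e (selEdges n A rest) else selEdges n A rest
      | none => selEdges n A rest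

/-- One round of the `K`-choice process: a set of `K` edges is presented, chosen
uniformly at random among the `K`-sets of edges missing from the algorithm's current
graph (if fewer than `K` edges are missing, all missing edges are presented). -/
noncomputable def step (n K : ℕ) (A : Alg n) (hist : List (Finset (Sym2 (Fin n)))) :
    PMF (List (Finset (Sym2 (Fin n)))) :=
  if h : (((allEdges n \ selEdges n A hist)).powersetCard K).Nonempty then
    (PMF.uniformOfFinset ((allEdges n \ selEdges n A hist).powersetCard K) h).map
      fun F => F :: hist
  else PMF.pure ((allEdges n \ selEdges n A hist) :: hist)

/-- The distribution of the history of the first `t` rounds of the `K`-choice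
process run against the algorithm `A` (most recent round first). -/
noncomputable def traj (n K : ℕ) (A : Alg n) : ℕ → PMF (List (Finset (Sym2 (Fin n))))
  | 0 => PMF.pure []
  | t + 1 => (traj n K A t).bind (step n K A)

/-- The presented sets of the first `t` rounds of a history (most recent first). -/
def firstRounds {n : ℕ} (t : ℕ) (hist : List (Finset (Sym2 (Fin n)))) :
    List (Finset (Sym2 (Fin n))) :=
  hist.drop (hist.length - t)

/-- The set of edges presented during the first `t` rounds of a history. -/
def presentedIn {n : ℕ} (t : ℕ) (hist : List (Finset (Sym2 (Fin n)))) :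
    Finset (Sym2 (Fin n)) :=
  (firstRounds t hist).foldr (· ∪ ·) ∅

/-- Every vertex is incident to at least `2` edges presented during the
first `t` rounds. -/
def MinDegTwo (n : ℕ) (hist : List (Finset (Sym2 (Fin n)))) (t : ℕ) : Prop :=
  ∀ v : Fin n, 2 ≤ ((presentedIn t hist).filter fun e => v ∈ e).card

/-- `t` is the hitting time `τ₂`: the minimum number of rounds after which every
vertex is incident to at least `2` presented edges. -/
def IsTauTwo (n : ℕ) (hist : List (Finset (Sym2 (Fin n)))) (t : ℕ) : Prop :=
  MinDegTwo n hist t ∧ ∀ s < t, ¬ MinDegTwo n hist s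

end KChoiceAdaptive

open KChoiceAdaptive

namespace KChoiceAdaptive

section TwoFactor

variable {V : Type*} [DecidableEq V]

/-- The edges of `E` incident to `v`. -/
def edgesAt (E : Finset (Sym2 V)) (v : V) : Finset (Sym2 V) :=
  E.filter fun e => v ∈ e

/-- `E` contains a spanning set of edges in which every vertex has degree two. -/
def HasTwoFactor (E : Finset (Sym2 V)) : Prop :=
  ∃ C ⊆ E, ∀ v, (edgesAt C v).card = 2

lemma mem_edgesAt {E : Finset (Sym2 V)} {v : V} {e : Sym2 V} :
    e ∈ edgesAt E v ↔ e ∈ E ∧ v ∈ e := by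
  simp [edgesAt]

lemma edgesAt_mono {E E' : Finset (Sym2 V)} (h : E ⊆ E') (v : V) : edgesAt E v ⊆ edgesAt E' v :=
  Finset.filter_subset_filter _ h

lemma card_edgesAt_mono {E E' : Finset (Sym2 V)} (h : E ⊆ E') (v : V) :
    (edgesAt E v).card ≤ (edgesAt E' v).card :=
  Finset.card_le_card (edgesAt_mono h v)

lemma sum_card_edgesAt [Fintype V] {E : Finset (Sym2 V)} (hE : ∀ e ∈ E, ¬ e.IsDiag) :
    ∑ v, (edgesAt E v).card = 2 * E.card := by
  have h := Finset.sum_card_bipartiteAbove_eq_sum_card_bipartiteBelow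
    (s := (Finset.univ : Finset V)) (t := E) (fun v e => v ∈ e)
  unfold Finset.bipartiteAbove Finset.bipartiteBelow at h
  unfold edgesAt
  rw [h, Finset.sum_congr rfl (g := fun _ => 2), Finset.sum_const, smul_eq_mul, mul_comm]
  intro e he
  rw [← Sym2.card_toFinset_of_not_isDiag e (hE e he)]
  congr 1
  ext v
  simp

lemma card_filter_mk_mem_le [Fintype V] (E : Finset (Sym2 V)) (v : V) :
    (Finset.univ.filter fun w => s(v, w) ∈ E).card ≤ (edgesAt E v).card := by
  refine Finset.card_le_card_of_injOn (fun w => s(v, w)) ?_ ?_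
  · intro w hw
    simpa [mem_edgesAt] using hw
  · intro a _ b _ h
    exact Sym2.congr_right.1 h

lemma hasTwoFactor_of_isHamiltonian [Fintype V] {E : Finset (Sym2 V)} (hV : 2 ≤ Fintype.card V)
    (h : (SimpleGraph.fromEdgeSet (E : Set (Sym2 V))).IsHamiltonian) : HasTwoFactor E := by
  obtain ⟨a, p, hp⟩ := h (by omega)
  refine ⟨p.edges.toFinset, ?_, ?_⟩
  · intro e he
    have := p.edges_subset_edgeSet (List.mem_toFinset.1 he)
    rw [SimpleGraph.edgeSet_fromEdgeSet] at this
    exact_mod_cast this.1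
  · intro v
    rw [← hp.isCycle.ncard_neighborSet_toSubgraph_eq_two (hp.mem_support v),
      ← Set.ncard_coe_finset]
    symm
    refine Set.ncard_congr (fun w _ => s(v, w)) ?_ ?_ ?_
    · intro w hw
      simp only [SimpleGraph.Subgraph.mem_neighborSet,
        SimpleGraph.Walk.adj_toSubgraph_iff_mem_edges] at hw
      simpa [mem_edgesAt] using hw
    · intro a b _ _ h
      exact Sym2.congr_right.1 h
    · intro e he
      simp only [Finset.mem_coe, mem_edgesAt, List.mem_toFinset] at he
      obtain ⟨he, w, rfl⟩ := he
      exact ⟨w, by simpa [SimpleGraph.Walk.adj_toSubgraph_iff_mem_edges] using he, rfl⟩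

lemma HasTwoFactor.two_le {E : Finset (Sym2 V)} (h : HasTwoFactor E) (v : V) :
    2 ≤ (edgesAt E v).card := by
  obtain ⟨C, hC, h2⟩ := h
  exact (h2 v).symm.le.trans (card_edgesAt_mono hC v)

lemma HasTwoFactor.card_le [Fintype V] {E : Finset (Sym2 V)} (hE : ∀ e ∈ E, ¬ e.IsDiag)
    (h : HasTwoFactor E) : Fintype.card V ≤ E.card := by
  have h1 : ∑ _v : V, 2 ≤ ∑ v, (edgesAt E v).card := Finset.sum_le_sum fun v _ => h.two_le v
  rw [sum_card_edgesAt hE] at h1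
  simp at h1
  omega

lemma edgesAt_insert_of_notMem {E : Finset (Sym2 V)} {e : Sym2 V} {x : V} (hx : x ∉ e) :
    edgesAt (insert e E) x = edgesAt E x := by
  ext f
  simp only [mem_edgesAt, Finset.mem_insert]
  constructor
  · rintro ⟨rfl | h, h'⟩
    · exact absurd h' hx
    · exact ⟨h, h'⟩
  · rintro ⟨h, h'⟩
    exact ⟨Or.inr h, h'⟩

lemma card_edgesAt_insert_le (E : Finset (Sym2 V)) (e : Sym2 V) (x : V) :
    (edgesAt (insert e E) x).card ≤ (edgesAt E x).card + 1 := by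
  refine le_trans (Finset.card_le_card ?_) (Finset.card_insert_le e _)
  intro f
  simp only [mem_edgesAt, Finset.mem_insert]
  tauto

/-- If adding the edge `vw` at the deficient vertex `v` creates a two-factor, then some
neighbour of `w` has degree at least three. -/
lemma exists_neighbor_three_le {E : Finset (Sym2 V)} {v w : V} (hE : ∀ e ∈ E, ¬ e.IsDiag)
    (hv : (edgesAt E v).card ≤ 1) (hw : 2 ≤ (edgesAt E w).card) (hvw : s(v, w) ∉ E)
    (h : HasTwoFactor (insert s(v, w) E)) :
    ∃ b, 3 ≤ (edgesAt E b).card ∧ s(b, w) ∈ E := by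
  obtain ⟨C, hC, h2⟩ := h
  have hmem : s(v, w) ∈ C := by
    by_contra hn
    have : C ⊆ E := fun e he => by
      rcases Finset.mem_insert.1 (hC he) with rfl | h
      · exact absurd he hn
      · exact h
    have := card_edgesAt_mono this v
    rw [h2] at this
    omega
  obtain ⟨f, hf, hfC⟩ : ∃ f ∈ edgesAt E w, f ∉ C := by
    by_contra! hn
    have hsub : insert s(v, w) (edgesAt E w) ⊆ edgesAt C w := by
      intro e he
      rcases Finset.mem_insert.1 he with rfl | he
      · simp [mem_edgesAt, hmem]
      · exact mem_edgesAt.2 ⟨hn e he, (mem_edgesAt.1 he).2⟩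
    have := Finset.card_le_card hsub
    rw [Finset.card_insert_of_notMem (by simp [mem_edgesAt, hvw]), h2] at this
    omega
  obtain ⟨hfE, b, rfl⟩ := mem_edgesAt.1 hf
  refine ⟨b, ?_, by rwa [Sym2.eq_swap]⟩
  have hbw : b ≠ w := by
    rintro rfl
    exact hE _ hfE (by simp)
  have hbv : b ≠ v := by
    rintro rfl
    exact hvw (by rwa [Sym2.eq_swap])
  have hsub : insert s(w, b) (edgesAt C b) ⊆ edgesAt E b := by
    intro e he
    rcases Finset.mem_insert.1 he with rfl | he
    · simp [mem_edgesAt, hfE]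
    · obtain ⟨h1, h3⟩ := mem_edgesAt.1 he
      refine mem_edgesAt.2 ⟨?_, h3⟩
      rcases Finset.mem_insert.1 (hC h1) with rfl | h
      · simp [hbw, hbv] at h3
      · exact h
  have := Finset.card_le_card hsub
  rwa [Finset.card_insert_of_notMem (by simp [mem_edgesAt, hfC]), h2] at this

/-- In a sparse edge set, a deficient vertex has few partners that create a two-factor. -/
lemma card_partners_le [Fintype V] {E : Finset (Sym2 V)} (hE : ∀ e ∈ E, ¬ e.IsDiag) {v : V}
    (hv : (edgesAt E v).card ≤ 1) {k : ℕ} (hk : E.card ≤ Fintype.card V + k) (S : Finset V)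
    (hS : ∀ w ∈ S, HasTwoFactor (insert s(v, w) E)) :
    S.card ≤ 6 * k + 9 := by
  rcases S.eq_empty_or_nonempty with rfl | ⟨w₀, hw₀⟩
  · simp
  set T : Finset V := Finset.univ.filter fun b => 3 ≤ (edgesAt E b).card with hT
  have hsub : S ⊆ insert v (insert w₀ ((Finset.univ.filter fun w => s(v, w) ∈ E) ∪
      T.biUnion fun b => Finset.univ.filter fun w => s(b, w) ∈ E)) := by
    intro w hw
    simp only [Finset.mem_insert, Finset.mem_union, Finset.mem_filter, Finset.mem_univ, true_and,
      Finset.mem_biUnion, hT]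
    by_contra! hn
    obtain ⟨hwv, hn1, hn2, hn3⟩ := hn
    have hvw : 2 ≤ (edgesAt E w).card := by
      have := (hS w₀ hw₀).two_le w
      rwa [edgesAt_insert_of_notMem (by simp [hwv, hn1])] at this
    obtain ⟨b, hb, hbw⟩ := exists_neighbor_three_le hE hv hvw hn2 (hS w hw)
    exact hn3 b hb hbw
  have hdeg : ∀ x : V, 6 + (if x ∈ T then (edgesAt E x).card else 0) ≤
      3 * (edgesAt E x).card + (if x = v then 3 else 0) + (if x = w₀ then 3 else 0) := by
    intro x
    have h1 := (hS w₀ hw₀).two_le x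
    have h3 := card_edgesAt_insert_le E s(v, w₀) x
    have h4 : x ≠ v → x ≠ w₀ → 2 ≤ (edgesAt E x).card := fun ha hb => by
      rwa [edgesAt_insert_of_notMem (by simp [ha, hb])] at h1
    by_cases hxT : 3 ≤ (edgesAt E x).card <;> by_cases ha : x = v <;> by_cases hb : x = w₀ <;>
      simp [hT, hxT, ha, hb] <;> grind
  have hsum := Finset.sum_le_sum fun x (_ : x ∈ Finset.univ) => hdeg x
  simp only [Finset.sum_add_distrib, ← Finset.mul_sum, sum_card_edgesAt hE, Finset.sum_ite_eq',
    Finset.mem_univ, if_true, Finset.sum_const, Finset.card_univ, smul_eq_mul, Finset.sum_ite_mem,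
    Finset.univ_inter] at hsum
  have h1 := (Finset.card_le_card hsub).trans (Finset.card_insert_le _ _)
  have h1' := Finset.card_insert_le w₀ ((Finset.univ.filter fun w => s(v, w) ∈ E) ∪
      T.biUnion fun b => Finset.univ.filter fun w => s(b, w) ∈ E)
  have h2 := Finset.card_union_le (Finset.univ.filter fun w => s(v, w) ∈ E)
      (T.biUnion fun b => Finset.univ.filter fun w => s(b, w) ∈ E)
  have h3 := card_filter_mk_mem_le E v
  have h4 : (T.biUnion fun b => Finset.univ.filter fun w => s(b, w) ∈ E).card ≤
      ∑ b ∈ T, (edgesAt E b).card :=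
    Finset.card_biUnion_le.trans (Finset.sum_le_sum fun b _ => card_filter_mk_mem_le E b)
  omega

end TwoFactor

section Sampling

variable {α : Type*} {M : Finset α} {K : ℕ}

/-- The expected number of elements of `G` in a random `K`-subset of `M`. -/
noncomputable def meanHits (K : ℕ) (M G : Finset α) : ℝ := G.card * K / M.card

lemma meanHits_nonneg (K : ℕ) (M G : Finset α) : 0 ≤ meanHits K M G := by
  unfold meanHits; positivity

variable [DecidableEq α]

lemma card_filter_mem_mul (hK : K ≤ M.card) {e : α} (he : e ∈ M) :
    ((M.powersetCard K).filter fun F => e ∈ F).card * M.card =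
      K * (M.powersetCard K).card := by
  rcases Nat.eq_zero_or_pos K with rfl | hK0
  · simp
  have h := Finset.card_filter_powersetCard_subset {e} M K (by simpa using he)
    (by rw [Finset.card_singleton]; exact hK0)
  simp only [Finset.singleton_subset_iff, Finset.card_singleton] at h
  rw [h, Finset.card_powersetCard]
  have := Nat.add_one_mul_choose_eq (M.card - 1) (K - 1)
  have h1 : M.card - 1 + 1 = M.card := by omega
  have h2 : K - 1 + 1 = K := by omega
  simp only [h1, h2] at this
  linarith

lemma card_filter_mem_mem_mul_le (hK : K ≤ M.card) {e f : α} (he : e ∈ M) (hf : f ∈ M)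
    (hef : e ≠ f) :
    ((M.powersetCard K).filter fun F => e ∈ F ∧ f ∈ F).card * M.card ^ 2 ≤
      K ^ 2 * (M.powersetCard K).card := by
  rcases Nat.lt_or_ge K 2 with hK0 | hK0
  · rw [Finset.filter_false_of_mem]
    · simp
    · rintro F hF ⟨h1, h2⟩
      have := Finset.card_le_card (s := {e, f}) (t := F)
        (by simp [Finset.insert_subset_iff, h1, h2])
      rw [Finset.card_pair hef, (Finset.mem_powersetCard.1 hF).2] at this
      omega
  have h := Finset.card_filter_powersetCard_subset {e, f} M K
    (by simp [Finset.insert_subset_iff, he, hf]) (by rw [Finset.card_pair hef]; exact hK0)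
  simp only [Finset.insert_subset_iff, Finset.singleton_subset_iff, Finset.card_pair hef] at h
  rw [h, Finset.card_powersetCard]
  obtain ⟨k, rfl⟩ : ∃ k, K = k + 2 := ⟨K - 2, by omega⟩
  obtain ⟨m, hm⟩ : ∃ m, M.card = m + 2 := ⟨M.card - 2, by omega⟩
  rw [hm] at hK ⊢
  simp only [Nat.add_sub_cancel]
  have h1 := Nat.add_one_mul_choose_eq m k
  have h2 := Nat.add_one_mul_choose_eq (m + 1) (k + 1)
  simp only [add_assoc, Nat.reduceAdd] at h1 h2
  have h3 : (k + 1) * (m + 2) ≤ (k + 2) * (m + 1) := by nlinarith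
  have h4 : (m + 1) * (m.choose k * (m + 2) ^ 2) ≤
      (m + 1) * ((k + 2) ^ 2 * (m + 2).choose (k + 2)) := by
    calc (m + 1) * (m.choose k * (m + 2) ^ 2) = ((m + 1) * m.choose k) * (m + 2) ^ 2 := by ring
      _ = ((m + 2) * (m + 1).choose (k + 1)) * ((k + 1) * (m + 2)) := by rw [h1]; ring
      _ = (k + 2) * (m + 2).choose (k + 2) * ((k + 1) * (m + 2)) := by rw [h2]; ring
      _ ≤ (k + 2) * (m + 2).choose (k + 2) * ((k + 2) * (m + 1)) := by gcongr
      _ = _ := by ring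
  exact Nat.le_of_mul_le_mul_left h4 (by omega)

lemma sum_card_inter_eq (hK : K ≤ M.card) (hM : 0 < M.card) {G : Finset α} (hG : G ⊆ M) :
    ∑ F ∈ M.powersetCard K, ((F ∩ G).card : ℝ) =
      meanHits K M G * (M.powersetCard K).card := by
  have h1 : ∑ F ∈ M.powersetCard K, (F ∩ G).card =
      ∑ e ∈ G, ((M.powersetCard K).filter fun F => e ∈ F).card := by
    have h := Finset.sum_card_bipartiteAbove_eq_sum_card_bipartiteBelow
      (s := G) (t := M.powersetCard K) (fun e F => e ∈ F)
    unfold Finset.bipartiteAbove Finset.bipartiteBelow at h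
    rw [h]
    refine Finset.sum_congr rfl fun F _ => ?_
    congr 1
    ext; simp [and_comm]
  have hM' : (0 : ℝ) < M.card := by exact_mod_cast hM
  have h2 : ∀ e ∈ G, (((M.powersetCard K).filter fun F => e ∈ F).card : ℝ) =
      K / M.card * (M.powersetCard K).card := fun e he => by
    have := card_filter_mem_mul hK (hG he)
    field_simp
    exact_mod_cast this
  rw [← Nat.cast_sum, h1, Nat.cast_sum, Finset.sum_congr rfl h2, Finset.sum_const, meanHits,
    nsmul_eq_mul]
  ring

lemma sum_card_inter_mul_pred_le (hK : K ≤ M.card) (hM : 0 < M.card) {G : Finset α} (hG : G ⊆ M) :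
    ∑ F ∈ M.powersetCard K, ((F ∩ G).card : ℝ) * ((F ∩ G).card - 1) ≤
      meanHits K M G ^ 2 * (M.powersetCard K).card := by
  have h1 : ∑ F ∈ M.powersetCard K, ((F ∩ G).offDiag).card =
      ∑ p ∈ G.offDiag, ((M.powersetCard K).filter fun F => p.1 ∈ F ∧ p.2 ∈ F).card := by
    have h := Finset.sum_card_bipartiteAbove_eq_sum_card_bipartiteBelow
      (s := G.offDiag) (t := M.powersetCard K) (fun p F => p.1 ∈ F ∧ p.2 ∈ F)
    unfold Finset.bipartiteAbove Finset.bipartiteBelow at h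
    rw [h]
    refine Finset.sum_congr rfl fun F _ => ?_
    congr 1
    ext p; simp [Finset.mem_offDiag]; tauto
  have hM' : (0 : ℝ) < M.card := by exact_mod_cast hM
  have h2 : ∀ p ∈ G.offDiag,
      (((M.powersetCard K).filter fun F => p.1 ∈ F ∧ p.2 ∈ F).card : ℝ) ≤
      K ^ 2 / M.card ^ 2 * (M.powersetCard K).card := fun p hp => by
    obtain ⟨ha, hb, hab⟩ := Finset.mem_offDiag.1 hp
    have := card_filter_mem_mem_mul_le hK (hG ha) (hG hb) hab
    rw [div_mul_eq_mul_div, le_div_iff₀ (by positivity)]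
    exact_mod_cast this
  have h3 : ∀ F : Finset α, ((F ∩ G).card : ℝ) * ((F ∩ G).card - 1) = ((F ∩ G).offDiag).card := by
    intro F
    rw [Finset.offDiag_card, Nat.cast_sub (Nat.le_mul_self _)]
    push_cast; ring
  simp only [h3]
  rw [← Nat.cast_sum, h1, Nat.cast_sum]
  refine (Finset.sum_le_sum h2).trans ?_
  rw [Finset.sum_const, nsmul_eq_mul, meanHits, ← mul_assoc]
  gcongr
  rw [div_pow, mul_pow, ← mul_div_assoc]
  gcongr
  rw [Finset.offDiag_card]
  exact_mod_cast (Nat.sub_le _ _).trans (sq _).ge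

lemma card_filter_nonempty_le (hK : K ≤ M.card) (hM : 0 < M.card) {G : Finset α} (hG : G ⊆ M) :
    (((M.powersetCard K).filter fun F => (F ∩ G).Nonempty).card : ℝ) ≤
      meanHits K M G * (M.powersetCard K).card := by
  rw [← sum_card_inter_eq hK hM hG, Finset.card_filter, Nat.cast_sum]
  refine Finset.sum_le_sum fun F _ => ?_
  split_ifs with h
  · exact_mod_cast h.card_pos
  · simp

lemma card_filter_two_le_le (hK : K ≤ M.card) (hM : 0 < M.card) {G : Finset α} (hG : G ⊆ M) :
    2 * (((M.powersetCard K).filter fun F => 2 ≤ (F ∩ G).card).card : ℝ) ≤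
      meanHits K M G ^ 2 * (M.powersetCard K).card := by
  refine le_trans ?_ (sum_card_inter_mul_pred_le hK hM hG)
  rw [Finset.card_filter, Nat.cast_sum, Finset.mul_sum]
  refine Finset.sum_le_sum fun F _ => ?_
  split_ifs with h
  · have : (2 : ℝ) ≤ (F ∩ G).card := by exact_mod_cast h
    push_cast
    nlinarith
  · have : (F ∩ G).card = 0 ∨ (F ∩ G).card = 1 := by omega
    rcases this with h | h <;> simp [h]

/-- A second moment bound: a random `K`-subset hits `G` with probability at least
`μ / (1 + μ)`, where `μ` is the expected number of hits. -/
lemma le_card_filter_nonempty (hK : K ≤ M.card) (hM : 0 < M.card) {G : Finset α} (hG : G ⊆ M) :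
    meanHits K M G / (1 + meanHits K M G) * (M.powersetCard K).card ≤
      (((M.powersetCard K).filter fun F => (F ∩ G).Nonempty).card : ℝ) := by
  set μ := meanHits K M G with hμ
  have hμ0 : 0 ≤ μ := meanHits_nonneg _ _ _
  set l := 1 / (1 + μ) with hl
  have h1 := sum_card_inter_eq hK hM hG
  have h2 := sum_card_inter_mul_pred_le hK hM hG
  have h3 : ∑ F ∈ M.powersetCard K, ((2 * l - l ^ 2) * ((F ∩ G).card : ℝ) -
      l ^ 2 * (((F ∩ G).card : ℝ) * ((F ∩ G).card - 1))) ≤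
      (((M.powersetCard K).filter fun F => (F ∩ G).Nonempty).card : ℝ) := by
    rw [Finset.card_filter, Nat.cast_sum]
    refine Finset.sum_le_sum fun F _ => ?_
    split_ifs with h
    · push_cast
      nlinarith [sq_nonneg (1 - l * ((F ∩ G).card : ℝ))]
    · simp [Finset.not_nonempty_iff_eq_empty.1 h]
  refine le_trans ?_ h3
  rw [Finset.sum_sub_distrib, ← Finset.mul_sum, ← Finset.mul_sum, h1, ← hμ]
  have h4 := mul_le_mul_of_nonneg_left h2 (sq_nonneg l)
  rw [← hμ] at h4
  refine le_trans (le_of_eq ?_) (sub_le_sub_left h4 _)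
  rw [hl]
  field_simp
  ring

lemma half_meanHits_mul_le (hK : K ≤ M.card) (hM : 0 < M.card) {G : Finset α} (hG : G ⊆ M)
    (hμ : meanHits K M G ≤ 1) :
    meanHits K M G / 2 * (M.powersetCard K).card ≤
      (((M.powersetCard K).filter fun F => (F ∩ G).Nonempty).card : ℝ) := by
  have h0 := meanHits_nonneg K M G
  refine le_trans ?_ (le_card_filter_nonempty hK hM hG)
  gcongr
  linarith

lemma card_filter_two_le_le_mul (hK : K ≤ M.card) (hM : 0 < M.card) {G : Finset α} (hG : G ⊆ M)
    (hμ : meanHits K M G ≤ 1) :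
    (((M.powersetCard K).filter fun F => 2 ≤ (F ∩ G).card).card : ℝ) ≤
      meanHits K M G * ((M.powersetCard K).filter fun F => (F ∩ G).Nonempty).card := by
  have h1 := card_filter_two_le_le hK hM hG
  have h2 := mul_le_mul_of_nonneg_left (half_meanHits_mul_le hK hM hG hμ) (meanHits_nonneg K M G)
  linarith

lemma card_filter_inter_nonempty_le_mul (hK : K ≤ M.card) (hM : 0 < M.card) {G : Finset α}
    (hG : G ⊆ M) (hμ : meanHits K M G ≤ 1) {I : Finset α} {c : ℝ}
    (hc : 0 ≤ c) (hI : 4 * (I.card : ℝ) ≤ c * G.card) :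
    (((M.powersetCard K).filter fun F => (F ∩ I).Nonempty).card : ℝ) ≤
      c / 2 * ((M.powersetCard K).filter fun F => (F ∩ G).Nonempty).card := by
  have h1 : ((M.powersetCard K).filter fun F => (F ∩ I).Nonempty) ⊆
      (M.powersetCard K).filter fun F => (F ∩ (I ∩ M)).Nonempty := by
    intro F hF
    rw [Finset.mem_filter] at hF ⊢
    obtain ⟨hF, e, he⟩ := hF
    rw [Finset.mem_inter] at he
    exact ⟨hF, e, Finset.mem_inter.2 ⟨he.1, Finset.mem_inter.2
      ⟨he.2, (Finset.mem_powersetCard.1 hF).1 he.1⟩⟩⟩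
  have h2 : ((I ∩ M).card : ℝ) ≤ I.card := by
    exact_mod_cast Finset.card_le_card Finset.inter_subset_left
  have h3 : meanHits K M (I ∩ M) ≤ c / 2 * (meanHits K M G / 2) := by
    have h4 : ((I ∩ M).card : ℝ) ≤ c / 4 * G.card := by linarith
    unfold meanHits
    calc ((I ∩ M).card : ℝ) * K / M.card ≤ c / 4 * G.card * K / M.card := by gcongr
      _ = c / 2 * (G.card * K / M.card / 2) := by ring
  calc (((M.powersetCard K).filter fun F => (F ∩ I).Nonempty).card : ℝ)
      ≤ ((M.powersetCard K).filter fun F => (F ∩ (I ∩ M)).Nonempty).card := by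
        exact_mod_cast Finset.card_le_card h1
    _ ≤ meanHits K M (I ∩ M) * (M.powersetCard K).card :=
        card_filter_nonempty_le hK hM Finset.inter_subset_right
    _ ≤ c / 2 * (meanHits K M G / 2) * (M.powersetCard K).card := by gcongr
    _ ≤ _ := by
        rw [mul_assoc]
        exact mul_le_mul_of_nonneg_left (half_meanHits_mul_le hK hM hG hμ) (by positivity)

end Sampling

section Trajectories

variable {n K : ℕ} {A : Alg n}

lemma mem_support_step {hist hist' : List (Finset (Sym2 (Fin n)))}
    (h : hist' ∈ (step n K A hist).support) :
    ∃ F ⊆ allEdges n \ selEdges n A hist, hist' = F :: hist := by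
  unfold step at h
  split_ifs at h with hne
  · obtain ⟨F, hF, rfl⟩ := (PMF.mem_support_map_iff _ _ _).1 h
    exact ⟨F, (Finset.mem_powersetCard.1 ((PMF.mem_support_uniformOfFinset_iff _ _).1 hF)).1, rfl⟩
  · exact ⟨_, subset_rfl, by simpa using h⟩

lemma cons_mem_support {t : ℕ} {hist : List (Finset (Sym2 (Fin n)))} {F : Finset (Sym2 (Fin n))}
    (h : hist ∈ (traj n K A t).support)
    (hF : F ∈ (allEdges n \ selEdges n A hist).powersetCard K) :
    F :: hist ∈ (traj n K A (t + 1)).support := by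
  refine (PMF.mem_support_bind_iff _ _ _).2 ⟨hist, h, ?_⟩
  rw [step, dif_pos ⟨F, hF⟩]
  exact (PMF.mem_support_map_iff _ _ _).2 ⟨F, (PMF.mem_support_uniformOfFinset_iff _ _).2 hF, rfl⟩

/-- The set of all edges presented along a history. -/
def presented (hist : List (Finset (Sym2 (Fin n)))) : Finset (Sym2 (Fin n)) :=
  hist.foldr (· ∪ ·) ∅

@[simp] lemma presented_nil : presented ([] : List (Finset (Sym2 (Fin n)))) = ∅ := rfl

@[simp] lemma presented_cons (F : Finset (Sym2 (Fin n))) (hist : List (Finset (Sym2 (Fin n)))) :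
    presented (F :: hist) = F ∪ presented hist := rfl

lemma selEdges_cons_eq (A : Alg n) (F : Finset (Sym2 (Fin n)))
    (hist : List (Finset (Sym2 (Fin n)))) :
    selEdges n A (F :: hist) = selEdges n A hist ∨
      ∃ e ∈ F, selEdges n A (F :: hist) = insert e (selEdges n A hist) := by
  rw [selEdges]
  split
  · split_ifs with h
    · exact Or.inr ⟨_, h, rfl⟩
    · exact Or.inl rfl
  · exact Or.inl rfl

lemma selEdges_subset_presented (A : Alg n) (hist : List (Finset (Sym2 (Fin n)))) :
    selEdges n A hist ⊆ presented hist := by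
  induction hist with
  | nil => simp [selEdges]
  | cons F hist ih =>
    rw [presented_cons]
    rcases selEdges_cons_eq A F hist with h | ⟨e, he, h⟩ <;> rw [h]
    · exact ih.trans Finset.subset_union_right
    · exact Finset.insert_subset (Finset.mem_union_left _ he) (ih.trans Finset.subset_union_right)

lemma selEdges_subset_cons (A : Alg n) (F : Finset (Sym2 (Fin n)))
    (hist : List (Finset (Sym2 (Fin n)))) :
    selEdges n A hist ⊆ selEdges n A (F :: hist) := by
  rcases selEdges_cons_eq A F hist with h | ⟨e, _, h⟩ <;> rw [h]
  exact Finset.subset_insert _ _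

lemma card_selEdges_le (A : Alg n) (hist : List (Finset (Sym2 (Fin n)))) :
    (selEdges n A hist).card ≤ hist.length := by
  induction hist with
  | nil => simp [selEdges]
  | cons F hist ih =>
    rw [List.length_cons]
    rcases selEdges_cons_eq A F hist with h | ⟨e, _, h⟩ <;> rw [h]
    · omega
    · exact (Finset.card_insert_le _ _).trans (by omega)

lemma length_eq_and_presented_subset {t : ℕ} {hist : List (Finset (Sym2 (Fin n)))}
    (h : hist ∈ (traj n K A t).support) :
    hist.length = t ∧ presented hist ⊆ allEdges n := by
  induction t generalizing hist with
  | zero =>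
    obtain rfl : hist = [] := by simpa [traj] using h
    simp
  | succ t ih =>
    obtain ⟨hist', h1, h2⟩ := (PMF.mem_support_bind_iff _ _ _).1 h
    obtain ⟨F, hF, rfl⟩ := mem_support_step h2
    obtain ⟨h3, h4⟩ := ih h1
    exact ⟨by simp [h3], Finset.union_subset (hF.trans Finset.sdiff_subset) h4⟩

lemma firstRounds_of_length_le {t : ℕ} {hist : List (Finset (Sym2 (Fin n)))}
    (h : hist.length ≤ t) : firstRounds t hist = hist := by
  simp [firstRounds, Nat.sub_eq_zero_of_le h]

lemma firstRounds_cons {t : ℕ} {hist : List (Finset (Sym2 (Fin n)))} (F : Finset (Sym2 (Fin n)))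
    (h : t ≤ hist.length) : firstRounds t (F :: hist) = firstRounds t hist := by
  simp only [firstRounds, List.length_cons]
  rw [show hist.length + 1 - t = (hist.length - t) + 1 by omega, List.drop_succ_cons]

lemma length_firstRounds_le (t : ℕ) (hist : List (Finset (Sym2 (Fin n)))) :
    (firstRounds t hist).length ≤ t := by
  simp [firstRounds]; omega

lemma presentedIn_mono {s t : ℕ} (h : s ≤ t) (hist : List (Finset (Sym2 (Fin n)))) :
    presentedIn s hist ⊆ presentedIn t hist := by
  induction hist with
  | nil => simp [presentedIn, firstRounds]
  | cons F hist ih =>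
    unfold presentedIn at ih ⊢
    rcases Nat.lt_or_ge hist.length t with ht | ht
    · rw [firstRounds_of_length_le (t := t) (by simpa using ht)]
      rcases Nat.lt_or_ge hist.length s with hs | hs
      · rw [firstRounds_of_length_le (t := s) (by simpa using hs)]
      · rw [firstRounds_cons F hs]
        rw [firstRounds_of_length_le (t := t) ht.le] at ih
        exact ih.trans Finset.subset_union_right
    · rw [firstRounds_cons F ht, firstRounds_cons F (h.trans ht)]
      exact ih

lemma presentedIn_eq_presented {t : ℕ} {hist : List (Finset (Sym2 (Fin n)))}
    (h : hist.length ≤ t) : presentedIn t hist = presented hist := by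
  rw [presentedIn, firstRounds_of_length_le h, presented]

/-- The total number of edges missing to reach degree two at every vertex. -/
def deficiency (E : Finset (Sym2 (Fin n))) : ℕ := ∑ v, (2 - (edgesAt E v).card)

lemma deficiency_eq_zero_iff {E : Finset (Sym2 (Fin n))} :
    deficiency E = 0 ↔ ∀ v, 2 ≤ (edgesAt E v).card := by
  simp [deficiency, Finset.sum_eq_zero_iff, Nat.sub_eq_zero_iff_le]

lemma deficiency_anti {E E' : Finset (Sym2 (Fin n))} (h : E ⊆ E') :
    deficiency E' ≤ deficiency E :=
  Finset.sum_le_sum fun v _ => Nat.sub_le_sub_left (card_edgesAt_mono h v) 2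

lemma minDegTwo_iff {t : ℕ} {hist : List (Finset (Sym2 (Fin n)))} :
    MinDegTwo n hist t ↔ deficiency (presentedIn t hist) = 0 :=
  deficiency_eq_zero_iff.symm

/-- The histories along which the algorithm's graph is Hamiltonian at the hitting time. -/
def winning (A : Alg n) : Set (List (Finset (Sym2 (Fin n)))) :=
  {hist | ∃ t, IsTauTwo n hist t ∧
    (SimpleGraph.fromEdgeSet
      (↑(selEdges n A (firstRounds t hist)) : Set (Sym2 (Fin n)))).IsHamiltonian}

lemma deficiency_eq_zero_of_isTauTwo {t : ℕ} {hist : List (Finset (Sym2 (Fin n)))}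
    (h : IsTauTwo n hist t) : deficiency (presented hist) = 0 := by
  have h1 := minDegTwo_iff.1 h.1
  have h2 := deficiency_anti (presentedIn_mono (le_max_left t hist.length) hist)
  rw [presentedIn_eq_presented (le_max_right _ _)] at h2
  omega

lemma le_length_of_isTauTwo {t : ℕ} {hist : List (Finset (Sym2 (Fin n)))}
    (h : IsTauTwo n hist t) : t ≤ hist.length := by
  by_contra! hlt
  refine h.2 _ hlt (minDegTwo_iff.2 ?_)
  rw [presentedIn_eq_presented le_rfl]
  exact deficiency_eq_zero_of_isTauTwo h

lemma minDegTwo_cons {t : ℕ} {hist : List (Finset (Sym2 (Fin n)))} (F : Finset (Sym2 (Fin n)))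
    (h : t ≤ hist.length) : MinDegTwo n (F :: hist) t ↔ MinDegTwo n hist t := by
  rw [minDegTwo_iff, minDegTwo_iff, presentedIn, firstRounds_cons F h, ← presentedIn]

lemma isTauTwo_cons {t : ℕ} {hist : List (Finset (Sym2 (Fin n)))} (F : Finset (Sym2 (Fin n)))
    (h : t ≤ hist.length) : IsTauTwo n (F :: hist) t ↔ IsTauTwo n hist t := by
  unfold IsTauTwo
  rw [minDegTwo_cons F h]
  refine and_congr_right fun _ => forall₂_congr fun s hs => ?_
  rw [minDegTwo_cons F (hs.le.trans h)]

lemma mem_winning_of_cons {hist : List (Finset (Sym2 (Fin n)))} {F : Finset (Sym2 (Fin n))}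
    (h0 : deficiency (presented hist) = 0) (h : F :: hist ∈ winning A) : hist ∈ winning A := by
  obtain ⟨t, ht, hH⟩ := h
  have htl : t ≤ hist.length := by
    by_contra! hlt
    refine ht.2 _ hlt ((minDegTwo_cons F le_rfl).2 (minDegTwo_iff.2 ?_))
    rwa [presentedIn_eq_presented le_rfl]
  refine ⟨t, (isTauTwo_cons F htl).1 ht, ?_⟩
  rwa [firstRounds_cons F htl] at hH

lemma isTauTwo_cons_length {hist : List (Finset (Sym2 (Fin n)))} {F : Finset (Sym2 (Fin n))}
    (h : deficiency (presented hist) ≠ 0) (h' : deficiency (presented (F :: hist)) = 0) :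
    IsTauTwo n (F :: hist) (hist.length + 1) := by
  refine ⟨minDegTwo_iff.2 ?_, fun s hs hm => h ?_⟩
  · rwa [presentedIn_eq_presented (by simp)]
  · have h1 := minDegTwo_iff.1 ((minDegTwo_cons F (by omega)).1 hm)
    have h2 := deficiency_anti (presentedIn_mono (show s ≤ hist.length by omega) hist)
    rw [presentedIn_eq_presented le_rfl] at h2
    omega

lemma deficiency_eq_zero_of_mem_winning {hist : List (Finset (Sym2 (Fin n)))}
    (h : hist ∈ winning A) : deficiency (presented hist) = 0 := by
  obtain ⟨t, ht, _⟩ := h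
  exact deficiency_eq_zero_of_isTauTwo ht

lemma isHamiltonian_of_cons_mem_winning {hist : List (Finset (Sym2 (Fin n)))}
    {F : Finset (Sym2 (Fin n))} (h0 : deficiency (presented hist) ≠ 0)
    (h : F :: hist ∈ winning A) :
    (SimpleGraph.fromEdgeSet
      (↑(selEdges n A (F :: hist)) : Set (Sym2 (Fin n)))).IsHamiltonian := by
  obtain ⟨t, ht, hH⟩ := h
  have htl : hist.length + 1 ≤ t := by
    by_contra! hlt
    exact h0 (deficiency_eq_zero_of_isTauTwo ((isTauTwo_cons F (by omega)).1 ht))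
  rwa [firstRounds_of_length_le (by simpa using htl)] at hH

/-- A supermartingale that dominates the indicator of `W` bounds its probability. -/
lemma toReal_toOuterMeasure_le (V : List (Finset (Sym2 (Fin n))) → ℝ) (hV : ∀ h, 0 ≤ V h)
    (W : Set (List (Finset (Sym2 (Fin n)))))
    (hstep : ∀ t, ∀ hist ∈ (traj n K A t).support,
      ∑ F ∈ (allEdges n \ selEdges n A hist).powersetCard K, V (F :: hist) ≤
        ((allEdges n \ selEdges n A hist).powersetCard K).card * V hist)
    (hstep' : ∀ t, ∀ hist ∈ (traj n K A t).support, (allEdges n \ selEdges n A hist).card < K →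
      V ((allEdges n \ selEdges n A hist) :: hist) ≤ V hist)
    (hW : ∀ t, ∀ hist ∈ (traj n K A t).support, hist ∈ W → 1 ≤ V hist) (L : ℕ) :
    ((traj n K A L).toOuterMeasure W).toReal ≤ V [] := by
  have hE : ∀ t, ∑' h, traj n K A t h * ENNReal.ofReal (V h) ≤ ENNReal.ofReal (V []) := by
    intro t
    induction t with
    | zero =>
      refine le_of_eq ?_
      rw [tsum_eq_single []]
      · simp [traj]
      · intro h hh
        simp [traj, hh]
    | succ t ih =>
      refine le_trans ?_ ih
      have h1 : ∑' h, traj n K A (t + 1) h * ENNReal.ofReal (V h) =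
          ∑' a, traj n K A t a * ∑' h, step n K A a h * ENNReal.ofReal (V h) := by
        simp only [traj, PMF.bind_apply, ← ENNReal.tsum_mul_right, ← ENNReal.tsum_mul_left]
        rw [ENNReal.tsum_comm]
        simp only [mul_assoc]
      rw [h1]
      refine ENNReal.tsum_le_tsum fun a => ?_
      by_cases ha : a ∈ (traj n K A t).support
      swap
      · rw [PMF.mem_support_iff, not_not] at ha
        simp [ha]
      gcongr
      rw [step]
      split_ifs with hne
      · set P := (allEdges n \ selEdges n A a).powersetCard K with hP
        have hP0 : (0 : ℝ) < P.card := by exact_mod_cast hne.card_pos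
        have h2 : ∑' h, ((PMF.uniformOfFinset P hne).map fun F => F :: a) h * ENNReal.ofReal (V h) =
            ∑' F, PMF.uniformOfFinset P hne F * ENNReal.ofReal (V (F :: a)) := by
          simp only [PMF.map_apply, ← ENNReal.tsum_mul_right]
          rw [ENNReal.tsum_comm]
          refine tsum_congr fun F => ?_
          rw [tsum_eq_single (F :: a)]
          · simp
          · intro h hh
            simp [hh]
        rw [h2, tsum_eq_sum (s := P)]
        · rw [Finset.sum_congr rfl (g := fun F =>
            (P.card : ENNReal)⁻¹ * ENNReal.ofReal (V (F :: a)))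
            (fun F hF => by rw [PMF.uniformOfFinset_apply_of_mem _ hF]), ← Finset.mul_sum,
            ← ENNReal.ofReal_sum_of_nonneg fun F _ => hV _]
          have h3 := ENNReal.ofReal_le_ofReal (hstep t a ha)
          rw [ENNReal.ofReal_mul hP0.le, ENNReal.ofReal_natCast] at h3
          rw [mul_comm, ← div_eq_mul_inv]
          refine ENNReal.div_le_of_le_mul ?_
          rwa [mul_comm]
        · intro F hF
          rw [PMF.uniformOfFinset_apply_of_notMem _ hF, zero_mul]
      · rw [Finset.powersetCard_nonempty, not_le] at hne
        rw [tsum_eq_single ((allEdges n \ selEdges n A a) :: a)]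
        · simp only [PMF.pure_apply_self, one_mul]
          exact ENNReal.ofReal_le_ofReal (hstep' t a ha hne)
        · intro h hh
          simp [PMF.pure_apply_of_ne _ _ hh]
  refine ENNReal.toReal_le_of_le_ofReal (hV _) (le_trans ?_ (hE L))
  rw [PMF.toOuterMeasure_apply]
  refine ENNReal.tsum_le_tsum fun h => ?_
  by_cases hh : h ∈ W
  · rw [Set.indicator_of_mem hh]
    by_cases hs : h ∈ (traj n K A L).support
    · refine le_mul_of_one_le_right' ?_
      rw [← ENNReal.ofReal_one]
      exact ENNReal.ofReal_le_ofReal (hW L h hs hh)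
    · rw [PMF.mem_support_iff, not_not] at hs
      simp [hs]
  · rw [Set.indicator_of_notMem hh]
    exact zero_le

end Trajectories

section Fresh

variable {n K : ℕ} {A : Alg n}

lemma two_mul_card_allEdges (n : ℕ) : 2 * (allEdges n).card = n * (n - 1) := by
  have h := Sym2.card_subtype_not_diag (α := Fin n)
  rw [Fintype.card_subtype, Fintype.card_fin] at h
  rw [allEdges, h, Nat.choose_two_right, Nat.mul_div_cancel' (Nat.even_mul_pred_self n).two_dvd]

lemma card_edgesAt_allEdges (v : Fin n) : (edgesAt (allEdges n) v).card + 1 = n := by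
  have h : edgesAt (allEdges n) v = (Finset.univ.erase v).image fun w => s(v, w) := by
    ext e
    simp only [mem_edgesAt, allEdges, Finset.mem_filter, Finset.mem_univ, true_and,
      Finset.mem_image, Finset.mem_erase, and_true]
    constructor
    · rintro ⟨h, w, rfl⟩
      exact ⟨w, by rintro rfl; simp at h, rfl⟩
    · rintro ⟨w, hw, rfl⟩
      exact ⟨by simpa using hw.symm, by simp⟩
  rw [h, Finset.card_image_of_injective _ fun a b h => Sym2.congr_right.1 h,
    Finset.card_erase_of_mem (Finset.mem_univ v), Finset.card_univ, Fintype.card_fin]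
  have := v.pos
  omega

/-- The edges at `v` outside `P`. -/
def freshAt (P : Finset (Sym2 (Fin n))) (v : Fin n) : Finset (Sym2 (Fin n)) :=
  edgesAt (allEdges n) v \ P

lemma mem_freshAt {P : Finset (Sym2 (Fin n))} {v : Fin n} {e : Sym2 (Fin n)} :
    e ∈ freshAt P v ↔ (e ∈ allEdges n ∧ v ∈ e) ∧ e ∉ P := by
  rw [freshAt, Finset.mem_sdiff, mem_edgesAt]

lemma le_card_freshAt {P : Finset (Sym2 (Fin n))} {v : Fin n} (hv : (edgesAt P v).card ≤ 1) :
    n ≤ (freshAt P v).card + 2 := by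
  have h1 : edgesAt (allEdges n) v ⊆ freshAt P v ∪ edgesAt P v := by
    intro e he
    have := mem_edgesAt.1 he
    by_cases h : e ∈ P
    · exact Finset.mem_union_right _ (mem_edgesAt.2 ⟨h, this.2⟩)
    · exact Finset.mem_union_left _ (mem_freshAt.2 ⟨this, h⟩)
  have h2 := (Finset.card_le_card h1).trans (Finset.card_union_le _ _)
  have h3 := card_edgesAt_allEdges v
  omega

lemma freshAt_subset {B P : Finset (Sym2 (Fin n))} (hBP : B ⊆ P) (v : Fin n) :
    freshAt P v ⊆ allEdges n \ B := fun _ he =>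
  Finset.mem_sdiff.2 ⟨(mem_freshAt.1 he).1.1, fun h => (mem_freshAt.1 he).2 (hBP h)⟩

lemma card_edgesAt_union_of_hit {F P : Finset (Sym2 (Fin n))} {v : Fin n}
    (h : (F ∩ freshAt P v).Nonempty) :
    (edgesAt P v).card + 1 ≤ (edgesAt (F ∪ P) v).card := by
  obtain ⟨e, he⟩ := h
  obtain ⟨heF, he⟩ := Finset.mem_inter.1 he
  obtain ⟨⟨_, hve⟩, heP⟩ := mem_freshAt.1 he
  rw [← Finset.card_insert_of_notMem (s := edgesAt P v) (a := e) (by simp [mem_edgesAt, heP])]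
  refine Finset.card_le_card (Finset.insert_subset ?_ (edgesAt_mono Finset.subset_union_right v))
  exact mem_edgesAt.2 ⟨Finset.mem_union_left _ heF, hve⟩

end Fresh

section ManyChoices

variable {n K : ℕ} {A : Alg n}

/-- The weight of a vertex of degree `d`. -/
noncomputable def weight (d : ℕ) : ℝ := if d = 0 then 4 else if d = 1 then 2 else 0

lemma weight_nonneg (d : ℕ) : 0 ≤ weight d := by
  unfold weight; split_ifs <;> norm_num

lemma weight_anti {d d' : ℕ} (h : d ≤ d') : weight d' ≤ weight d := by
  unfold weight; split_ifs <;> first | omega | norm_num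

lemma weight_le_half {d d' : ℕ} (h : d + 1 ≤ d') : weight d' ≤ weight d / 2 := by
  unfold weight; split_ifs <;> first | omega | norm_num

/-- The total weight of the vertices. -/
noncomputable def totalWeight (E : Finset (Sym2 (Fin n))) : ℝ :=
  ∑ v, weight (edgesAt E v).card

lemma totalWeight_nonneg (E : Finset (Sym2 (Fin n))) : 0 ≤ totalWeight E :=
  Finset.sum_nonneg fun _ _ => weight_nonneg _

lemma totalWeight_empty : totalWeight (∅ : Finset (Sym2 (Fin n))) = 4 * n := by
  simp [totalWeight, edgesAt, weight, mul_comm]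

lemma one_le_totalWeight {E : Finset (Sym2 (Fin n))} (h : deficiency E ≠ 0) :
    1 ≤ totalWeight E := by
  rw [Ne, deficiency_eq_zero_iff] at h
  push Not at h
  obtain ⟨v, hv⟩ := h
  refine le_trans ?_ (Finset.single_le_sum (fun v _ => weight_nonneg _) (Finset.mem_univ v))
  unfold weight
  split_ifs <;> first | omega | norm_num

/-- The factor by which the expected total weight decreases in a round. -/
noncomputable def decay (n K : ℕ) : ℝ := 1 - K / (n + K : ℝ) / 2

lemma half_le_decay (n K : ℕ) : 1 / 2 ≤ decay n K := by
  have : (K : ℝ) / (n + K : ℝ) ≤ 1 := div_le_one_of_le₀ (by simp) (by positivity)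
  unfold decay
  linarith

lemma sum_totalWeight_le (hn : 3 ≤ n) {B P : Finset (Sym2 (Fin n))} (hBP : B ⊆ P)
    (hK : K ≤ (allEdges n \ B).card) :
    ∑ F ∈ (allEdges n \ B).powersetCard K, totalWeight (F ∪ P) ≤
      ((allEdges n \ B).powersetCard K).card * (decay n K * totalWeight P) := by
  unfold totalWeight
  rw [Finset.sum_comm, Finset.mul_sum, Finset.mul_sum]
  refine Finset.sum_le_sum fun v _ => ?_
  set M := allEdges n \ B with hM
  by_cases hv : 2 ≤ (edgesAt P v).card
  · have h0 : ∀ d, 2 ≤ d → weight d = 0 := fun d hd => by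
      unfold weight; split_ifs <;> first | omega | rfl
    rw [h0 _ hv, Finset.sum_eq_zero]
    · simp
    · exact fun F _ => h0 _ (hv.trans (card_edgesAt_mono Finset.subset_union_right v))
  have hv1 : (edgesAt P v).card ≤ 1 := by omega
  have hG : freshAt P v ⊆ M := freshAt_subset hBP v
  have hg := le_card_freshAt hv1
  have hM0 : 0 < M.card := by
    have := Finset.card_le_card hG
    omega
  set w := weight (edgesAt P v).card with hw
  have hw0 : 0 ≤ w := weight_nonneg _
  have hpt : ∀ F ∈ M.powersetCard K, weight (edgesAt (F ∪ P) v).card ≤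
      w - w / 2 * (if (F ∩ freshAt P v).Nonempty then 1 else 0) := by
    intro F _
    split_ifs with h
    · have := weight_le_half (card_edgesAt_union_of_hit h)
      linarith
    · simpa using weight_anti (card_edgesAt_mono Finset.subset_union_right v)
  refine (Finset.sum_le_sum hpt).trans ?_
  rw [Finset.sum_sub_distrib, ← Finset.mul_sum, Finset.sum_boole, Finset.sum_const, nsmul_eq_mul]
  have hhit := le_card_filter_nonempty hK hM0 hG
  have hμ : (K : ℝ) / n ≤ meanHits K M (freshAt P v) := by
    have h1 : 2 * M.card ≤ n * (n - 1) := by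
      rw [← two_mul_card_allEdges]
      exact Nat.mul_le_mul_left 2 (Finset.card_le_card Finset.sdiff_subset)
    have h2 : M.card ≤ (freshAt P v).card * n := by
      have : n * (n - 1) ≤ 2 * ((freshAt P v).card * n) := by
        rw [mul_comm n, ← mul_assoc]
        exact Nat.mul_le_mul_right n (by omega)
      omega
    have hn0 : (0 : ℝ) < n := by exact_mod_cast (by omega : 0 < n)
    have hM' : (0 : ℝ) < M.card := by exact_mod_cast hM0
    have h3 : (M.card : ℝ) ≤ (freshAt P v).card * n := by exact_mod_cast h2
    rw [meanHits, div_le_div_iff₀ hn0 hM']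
    nlinarith [(Nat.cast_nonneg K : (0 : ℝ) ≤ K)]
  have hfrac : (K : ℝ) / (n + K) ≤
      meanHits K M (freshAt P v) / (1 + meanHits K M (freshAt P v)) := by
    set μ := meanHits K M (freshAt P v)
    have hμ0 : 0 ≤ μ := meanHits_nonneg _ _ _
    have hn0 : (0 : ℝ) < n := by exact_mod_cast (by omega : 0 < n)
    rw [div_le_iff₀ hn0] at hμ
    rw [div_le_div_iff₀ (by positivity) (by positivity)]
    nlinarith
  have h4 := mul_le_mul_of_nonneg_right hfrac (Nat.cast_nonneg (α := ℝ) (M.powersetCard K).card)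
  have h5 := mul_le_mul_of_nonneg_left (h4.trans hhit) (by positivity : 0 ≤ w / 2)
  unfold decay
  linarith

lemma presentedIn_subset (t : ℕ) (hist : List (Finset (Sym2 (Fin n)))) :
    presentedIn t hist ⊆ presented hist := by
  have := presentedIn_mono (le_max_left t hist.length) hist
  rwa [presentedIn_eq_presented (le_max_right _ _)] at this

lemma selEdges_firstRounds_not_isDiag {t s : ℕ} {hist : List (Finset (Sym2 (Fin n)))}
    (h : hist ∈ (traj n K A t).support) :
    ∀ e ∈ selEdges n A (firstRounds s hist), ¬ e.IsDiag := fun _ he =>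
  (Finset.mem_filter.1 ((length_eq_and_presented_subset h).2
    (presentedIn_subset s hist (selEdges_subset_presented A _ he)))).2

/-- With many choices the hitting time is too small for `n` edges to be selected. -/
lemma probability_le_decay (hn : 3 ≤ n) (L : ℕ) :
    ((traj n K A L).toOuterMeasure (winning A)).toReal ≤ decay n K ^ (n - 1) * (4 * n) := by
  have hρ := half_le_decay n K
  set ρ := decay n K with hρd
  have hρ0 : 0 ≤ ρ := by linarith
  set V : List (Finset (Sym2 (Fin n))) → ℝ := fun hist =>
    ρ ^ (n - 1 - hist.length) * totalWeight (presented (firstRounds (n - 1) hist)) with hV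
  have hlate : ∀ F hist, n - 1 ≤ hist.length → V (F :: hist) = V hist := by
    intro F hist h
    simp only [hV, List.length_cons]
    rw [firstRounds_cons F h]
    congr 2
    omega
  have hearly : ∀ F hist, hist.length < n - 1 →
      V (F :: hist) = ρ ^ (n - 1 - hist.length - 1) * totalWeight (F ∪ presented hist) := by
    intro F hist h
    simp only [hV, List.length_cons]
    rw [firstRounds_of_length_le (by simpa using h), presented_cons, Nat.sub_add_eq]
  have hearly' : ∀ hist : List (Finset (Sym2 (Fin n))), hist.length < n - 1 →
      V hist = ρ ^ (n - 1 - hist.length - 1) * (ρ * totalWeight (presented hist)) := by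
    intro hist h
    simp only [hV]
    rw [firstRounds_of_length_le h.le, ← mul_assoc, ← pow_succ]
    congr 2
    omega
  have hnil : V [] = ρ ^ (n - 1) * (4 * n) := by
    simp [hV, firstRounds, totalWeight_empty]
  rw [← hnil]
  refine toReal_toOuterMeasure_le V
    (fun _ => mul_nonneg (pow_nonneg hρ0 _) (totalWeight_nonneg _)) _ ?_ ?_ ?_ L
  · intro t hist _
    rcases Nat.lt_or_ge hist.length (n - 1) with hl | hl
    swap
    · simp only [hlate _ _ hl, Finset.sum_const, nsmul_eq_mul, le_refl]
    simp only [hearly _ _ hl, hearly' _ hl]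
    rw [← Finset.mul_sum, mul_left_comm]
    refine mul_le_mul_of_nonneg_left ?_ (pow_nonneg hρ0 _)
    by_cases hK : K ≤ (allEdges n \ selEdges n A hist).card
    · exact sum_totalWeight_le hn (selEdges_subset_presented A hist) hK
    · rw [Finset.powersetCard_eq_empty.2 (by omega)]
      simp
  · intro t hist _ _
    rcases Nat.lt_or_ge hist.length (n - 1) with hl | hl
    swap
    · exact (hlate _ _ hl).le
    rw [hearly _ _ hl, hearly' _ hl]
    refine mul_le_mul_of_nonneg_left ?_ (pow_nonneg hρ0 _)
    unfold totalWeight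
    rw [Finset.mul_sum]
    refine Finset.sum_le_sum fun v _ => ?_
    set P := presented hist
    have hw := weight_nonneg (edgesAt P v).card
    by_cases hv : (edgesAt P v).card ≤ 1
    · have hne : ((allEdges n \ selEdges n A hist) ∩ freshAt P v).Nonempty := by
        rw [Finset.inter_eq_right.2 (freshAt_subset (selEdges_subset_presented A hist) v)]
        have := le_card_freshAt hv
        exact Finset.card_pos.1 (show 0 < (freshAt P v).card by omega)
      have := weight_le_half (card_edgesAt_union_of_hit hne)
      nlinarith
    · have h2 := card_edgesAt_mono (show P ⊆ (allEdges n \ selEdges n A hist) ∪ P from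
        Finset.subset_union_right) v
      have h3 : weight (edgesAt ((allEdges n \ selEdges n A hist) ∪ P) v).card = 0 := by
        unfold weight; split_ifs <;> first | omega | rfl
      rw [h3]
      positivity
  · rintro t hist hs ⟨s, hs1, hs2⟩
    have h1 := (hasTwoFactor_of_isHamiltonian (by rw [Fintype.card_fin]; omega) hs2).card_le
      (selEdges_firstRounds_not_isDiag hs)
    rw [Fintype.card_fin] at h1
    have h2 := (card_selEdges_le A (firstRounds s hist)).trans (length_firstRounds_le s hist)
    have h3 := le_length_of_isTauTwo hs1
    have h4 := one_le_totalWeight (mt minDegTwo_iff.2 (hs1.2 (n - 1) (by omega)))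
    simp only [hV]
    rw [Nat.sub_eq_zero_of_le (by omega), pow_zero, one_mul]
    exact h4

/-- If `K` is at least of order `n ^ (1 / 3)`, then the bound from the total weight is small. -/
lemma decay_bound (hn : 10 ^ 31 ≤ n) (hK : n < 1000 * K ^ 3) :
    decay n K ^ (n - 1) * (4 * n) ≤ 3 / 4 := by
  obtain ⟨k, hk⟩ : ∃ k, k = min K n := ⟨_, rfl⟩
  have hkn : n < 1000 * k ^ 3 := by
    rcases le_total K n with h | h
    · rwa [hk, min_eq_left h]
    · rw [hk, min_eq_right h]
      have : n * 1 ≤ n * n ^ 2 := Nat.mul_le_mul_left n (Nat.one_le_pow _ _ (by omega))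
      nlinarith
  have hk9 : 10 ^ 9 ≤ k := by
    by_contra! h
    have := Nat.pow_le_pow_left h.le 3
    omega
  have hkK : (k : ℝ) ≤ K := by exact_mod_cast hk ▸ min_le_left _ _
  have hkn' : (k : ℝ) ≤ n := by exact_mod_cast hk ▸ min_le_right _ _
  have hk9' : (10 : ℝ) ^ 9 ≤ k := by exact_mod_cast hk9
  have hk0 : (0 : ℝ) < k := lt_of_lt_of_le (by norm_num) hk9'
  have hn0 : (0 : ℝ) < n := hk0.trans_le hkn'
  have hn1 : ((n - 1 : ℕ) : ℝ) = n - 1 := by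
    rw [Nat.cast_sub (by omega), Nat.cast_one]
  set p : ℝ := K / (n + K : ℝ) / 2 with hp
  have hfrac : (k : ℝ) / (4 * n) ≤ p := by
    rw [hp, div_div, div_le_div_iff₀ (by positivity) (by positivity)]
    nlinarith
  set z : ℝ := (n - 1 : ℕ) * p with hz
  have hzk : (k : ℝ) / 8 ≤ z := by
    have h1 : (n : ℝ) / 2 ≤ (n - 1 : ℕ) := by
      rw [hn1]
      nlinarith
    calc (k : ℝ) / 8 = n / 2 * (k / (4 * n)) := by field_simp; norm_num
      _ ≤ z := by rw [hz]; gcongr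
  have hexp : decay n K ^ (n - 1) ≤ Real.exp (-z) := by
    have h1 : decay n K ≤ Real.exp (-p) := by
      have := Real.add_one_le_exp (-p)
      unfold decay
      linarith
    calc decay n K ^ (n - 1) ≤ Real.exp (-p) ^ (n - 1) :=
          pow_le_pow_left₀ (by linarith [half_le_decay n K]) h1 _
      _ = Real.exp (-z) := by rw [← Real.exp_nat_mul, hz]; ring_nf
  have hpow : (k : ℝ) ^ 4 / 98304 ≤ Real.exp z := by
    have h1 := Real.pow_div_factorial_le_exp z (by linarith [hzk, hk0]) 4
    have h2 : ((k : ℝ) / 8) ^ 4 ≤ z ^ 4 := by gcongr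
    norm_num [Nat.factorial] at h1
    rw [div_pow] at h2
    linarith
  have hkn3 : (n : ℝ) ≤ 1000 * k ^ 3 := by exact_mod_cast hkn.le
  calc decay n K ^ (n - 1) * (4 * n) ≤ Real.exp (-z) * (4 * n) := by gcongr
    _ = 4 * n / Real.exp z := by rw [Real.exp_neg]; field_simp
    _ ≤ 4 * (1000 * k ^ 3) / (k ^ 4 / 98304) := by gcongr
    _ = 393216000 / k := by field_simp; norm_num
    _ ≤ 3 / 4 := by
      rw [div_le_div_iff₀ hk0 (by norm_num)]
      linarith

end ManyChoices

section FewChoices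

variable {n K : ℕ} {A : Alg n}

/-- The vertices of degree at most one. -/
def low (P : Finset (Sym2 (Fin n))) : Finset (Fin n) :=
  Finset.univ.filter fun v => (edgesAt P v).card ≤ 1

lemma mem_low {P : Finset (Sym2 (Fin n))} {v : Fin n} :
    v ∈ low P ↔ (edgesAt P v).card ≤ 1 := by
  simp [low]

/-- The edges outside `P` that are incident to a vertex of low degree. -/
def freshLow (P : Finset (Sym2 (Fin n))) : Finset (Sym2 (Fin n)) :=
  (low P).biUnion (freshAt P)

lemma mem_freshLow {P : Finset (Sym2 (Fin n))} {e : Sym2 (Fin n)} :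
    e ∈ freshLow P ↔ ∃ v, (edgesAt P v).card ≤ 1 ∧ e ∈ freshAt P v := by
  simp [freshLow, mem_low]

lemma card_low_le (P : Finset (Sym2 (Fin n))) : (low P).card ≤ deficiency P := by
  rw [low, Finset.card_filter]
  refine Finset.sum_le_sum fun v _ => ?_
  split_ifs <;> omega

lemma low_nonempty {P : Finset (Sym2 (Fin n))} (h : deficiency P ≠ 0) : (low P).Nonempty := by
  rw [Ne, deficiency_eq_zero_iff] at h
  push Not at h
  obtain ⟨v, hv⟩ := h
  exact ⟨v, mem_low.2 (by omega)⟩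

lemma freshLow_subset {B P : Finset (Sym2 (Fin n))} (hBP : B ⊆ P) :
    freshLow P ⊆ allEdges n \ B :=
  Finset.biUnion_subset.2 fun v _ => freshAt_subset hBP v

lemma card_freshLow_le (P : Finset (Sym2 (Fin n))) : (freshLow P).card ≤ deficiency P * n := by
  refine (Finset.card_biUnion_le_card_mul _ _ n fun v _ => ?_).trans
    (Nat.mul_le_mul_right n (card_low_le P))
  have h : (freshAt P v).card ≤ _ := Finset.card_le_card Finset.sdiff_subset
  have := card_edgesAt_allEdges v
  omega

lemma le_card_freshLow {P : Finset (Sym2 (Fin n))} (h : deficiency P ≠ 0) :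
    n ≤ (freshLow P).card + 2 := by
  obtain ⟨v, hv⟩ := low_nonempty h
  have h1 := Finset.card_le_card (Finset.subset_biUnion_of_mem (freshAt P) hv)
  have h2 := le_card_freshAt (mem_low.1 hv)
  unfold freshLow
  omega

lemma deficiency_union_lt {F P : Finset (Sym2 (Fin n))} (h : (F ∩ freshLow P).Nonempty) :
    deficiency (F ∪ P) + 1 ≤ deficiency P := by
  obtain ⟨e, he⟩ := h
  obtain ⟨heF, he⟩ := Finset.mem_inter.1 he
  obtain ⟨v, hv, he⟩ := mem_freshLow.1 he
  refine Finset.sum_lt_sum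
    (fun w _ => Nat.sub_le_sub_left (card_edgesAt_mono Finset.subset_union_right w) 2)
    ⟨v, Finset.mem_univ v, ?_⟩
  have := card_edgesAt_union_of_hit (P := P) (v := v) ⟨e, Finset.mem_inter.2 ⟨heF, he⟩⟩
  omega

lemma deficiency_le_union_add {F P : Finset (Sym2 (Fin n))} (hF : F ⊆ allEdges n) :
    deficiency P ≤ deficiency (F ∪ P) +
      ∑ e ∈ F ∩ freshLow P, ((low P).filter fun v => v ∈ e).card := by
  have h := Finset.sum_card_bipartiteAbove_eq_sum_card_bipartiteBelow
    (s := low P) (t := F ∩ freshLow P) (fun v e => v ∈ e)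
  unfold Finset.bipartiteAbove Finset.bipartiteBelow at h
  rw [← h, ← Finset.univ_inter (low P), ← Finset.sum_ite_mem, deficiency, deficiency,
    ← Finset.sum_add_distrib]
  refine Finset.sum_le_sum fun v _ => ?_
  split_ifs with hv
  · have h1 : edgesAt (F ∪ P) v ⊆ edgesAt P v ∪ (F ∩ freshLow P).filter fun e => v ∈ e := by
      intro e he
      obtain ⟨h1, h2⟩ := mem_edgesAt.1 he
      by_cases heP : e ∈ P
      · exact Finset.mem_union_left _ (mem_edgesAt.2 ⟨heP, h2⟩)
      have heF : e ∈ F := (Finset.mem_union.1 h1).resolve_right heP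
      refine Finset.mem_union_right _ (Finset.mem_filter.2 ⟨Finset.mem_inter.2 ⟨heF, ?_⟩, h2⟩)
      exact mem_freshLow.2 ⟨v, mem_low.1 hv, mem_freshAt.2 ⟨⟨hF heF, h2⟩, heP⟩⟩
    have h2 := (Finset.card_le_card h1).trans (Finset.card_union_le _ _)
    beta_reduce
    omega
  · have := mt mem_low.2 hv
    omega

/-- The edges joining two vertices of low degree. -/
def innerLow (P : Finset (Sym2 (Fin n))) : Finset (Sym2 (Fin n)) :=
  (low P ×ˢ low P).image fun p => s(p.1, p.2)

lemma card_innerLow_le (P : Finset (Sym2 (Fin n))) :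
    (innerLow P).card ≤ deficiency P * deficiency P := by
  refine Finset.card_image_le.trans ?_
  rw [Finset.card_product]
  exact Nat.mul_le_mul (card_low_le P) (card_low_le P)

lemma card_filter_mem_sym2_le {E : Finset (Fin n)} (e : Sym2 (Fin n)) :
    (E.filter fun v => v ∈ e).card ≤ 2 := by
  have h : (E.filter fun v => v ∈ e) ⊆ e.toFinset := fun v hv => by
    simpa using (Finset.mem_filter.1 hv).2
  refine (Finset.card_le_card h).trans ?_
  rw [Sym2.card_toFinset]
  split_ifs <;> omega

lemma deficiency_le_two_mul {F P : Finset (Sym2 (Fin n))} (hF : F ⊆ allEdges n)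
    (h0 : deficiency (F ∪ P) = 0) : deficiency P ≤ 2 * (F ∩ freshLow P).card := by
  have h := deficiency_le_union_add (P := P) hF
  rw [h0, zero_add] at h
  refine h.trans ((Finset.sum_le_card_nsmul _ _ 2 fun e _ => card_filter_mem_sym2_le e).trans ?_)
  rw [smul_eq_mul, mul_comm]

/-- Removing a deficiency of at least two in a single round needs two useful edges or an
edge between two vertices of low degree. -/
lemma two_le_or_inner {F P : Finset (Sym2 (Fin n))} (hF : F ⊆ allEdges n)
    (h2 : 2 ≤ deficiency P) (h0 : deficiency (F ∪ P) = 0) :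
    2 ≤ (F ∩ freshLow P).card ∨ (F ∩ innerLow P).Nonempty := by
  by_contra! hn
  obtain ⟨hn1, hn2⟩ := hn
  have h1 := deficiency_le_two_mul hF h0
  obtain ⟨e, he⟩ := Finset.card_eq_one.1 (show (F ∩ freshLow P).card = 1 by omega)
  have h := deficiency_le_union_add (P := P) hF
  rw [h0, zero_add, he, Finset.sum_singleton] at h
  obtain ⟨x, hx, y, hy, hxy⟩ := Finset.one_lt_card.1 (h2.trans h)
  rw [Finset.mem_filter] at hx hy
  obtain rfl : e = s(x, y) := (Sym2.mem_and_mem_iff hxy).1 ⟨hx.2, hy.2⟩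
  have heF : s(x, y) ∈ F := (Finset.mem_inter.1 (he ▸ Finset.mem_singleton_self _ :
    s(x, y) ∈ F ∩ freshLow P)).1
  refine Finset.notMem_empty s(x, y) (hn2 ▸ Finset.mem_inter.2 ⟨heF, ?_⟩)
  exact Finset.mem_image.2 ⟨(x, y), Finset.mem_product.2 ⟨hx.1, hy.1⟩, rfl⟩

/-- The edges at `v` whose addition to `B` creates a two-factor. -/
noncomputable def completing (B : Finset (Sym2 (Fin n))) (v : Fin n) : Finset (Sym2 (Fin n)) :=
  open Classical in
  (Finset.univ.filter fun w => HasTwoFactor (insert s(v, w) B)).image fun w => s(v, w)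

lemma card_completing_le {B : Finset (Sym2 (Fin n))} {v : Fin n} (hB : ∀ e ∈ B, ¬ e.IsDiag)
    (hv : (edgesAt B v).card ≤ 1) {k : ℕ} (hk : B.card ≤ n + k) :
    (completing B v).card ≤ 6 * k + 9 := by
  classical
  refine Finset.card_image_le.trans (card_partners_le hB hv (by rwa [Fintype.card_fin]) _ ?_)
  intro w hw
  simpa using hw

lemma completing_of_mem_winning (hn : 2 ≤ n) {hist : List (Finset (Sym2 (Fin n)))}
    {F : Finset (Sym2 (Fin n))} {v : Fin n} (h0 : deficiency (presented hist) ≠ 0)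
    (hv : (edgesAt (presented hist) v).card ≤ 1) (h : F :: hist ∈ winning A) :
    (F ∩ completing (selEdges n A hist) v).Nonempty := by
  have hT := hasTwoFactor_of_isHamiltonian (by rwa [Fintype.card_fin])
    (isHamiltonian_of_cons_mem_winning h0 h)
  have hB := card_edgesAt_mono (selEdges_subset_presented A hist) v
  have h2 := hT.two_le v
  rcases selEdges_cons_eq A F hist with he | ⟨e, heF, he⟩
  · rw [he] at h2
    omega
  rw [he] at h2 hT
  by_cases hve : v ∈ e
  · obtain ⟨w, rfl⟩ := hve
    refine ⟨s(v, w), Finset.mem_inter.2 ⟨heF, ?_⟩⟩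
    classical
    exact Finset.mem_image.2 ⟨w, by simpa using hT, rfl⟩
  · rw [edgesAt_insert_of_notMem hve] at h2
    omega

/-- The bound on the winning probability used as a potential function. -/
noncomputable def potential (K : ℕ) (A : Alg n) (hist : List (Finset (Sym2 (Fin n)))) : ℝ :=
  open Classical in
  if hist ∈ winning A then 1 else if deficiency (presented hist) = 0 then 0 else
    1 / 2 + 100 * (K : ℝ) ^ 2 / n * min (deficiency (presented hist) : ℝ) (2 * K)

lemma potential_nonneg (hist : List (Finset (Sym2 (Fin n)))) : 0 ≤ potential K A hist := by
  unfold potential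
  split_ifs <;> positivity

lemma potential_of_ne {hist : List (Finset (Sym2 (Fin n)))}
    (h : deficiency (presented hist) ≠ 0) :
    potential K A hist =
      1 / 2 + 100 * (K : ℝ) ^ 2 / n * min (deficiency (presented hist) : ℝ) (2 * K) := by
  rw [potential, if_neg (fun hw => h (deficiency_eq_zero_of_mem_winning hw)), if_neg h]

lemma potential_cons_le_of_eq {hist : List (Finset (Sym2 (Fin n)))} (F : Finset (Sym2 (Fin n)))
    (h : deficiency (presented hist) = 0) :
    potential K A (F :: hist) ≤ potential K A hist := by
  have h' : deficiency (presented (F :: hist)) = 0 :=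
    Nat.le_zero.1 (h ▸ deficiency_anti Finset.subset_union_right)
  unfold potential
  rw [if_pos h, if_pos h']
  split_ifs with h1 h2
  · exact le_rfl
  · exact absurd (mem_winning_of_cons h h1) h2
  · exact zero_le_one
  · exact le_rfl

lemma card_winning_le (hn : 1000 ≤ n) (hK : 1 ≤ K) (hK3 : 1000 * K ^ 3 ≤ n)
    {hist : List (Finset (Sym2 (Fin n)))} (hP : presented hist ⊆ allEdges n)
    (hd : deficiency (presented hist) ≠ 0) (hd2 : deficiency (presented hist) ≤ 2 * K)
    (hB : (selEdges n A hist).card ≤ n + n / 100)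
    {W : Finset (Finset (Sym2 (Fin n)))}
    (hW : ∀ F ∈ W, F ∈ (allEdges n \ selEdges n A hist).powersetCard K ∧
      F :: hist ∈ winning A) :
    (W.card : ℝ) ≤
      (if deficiency (presented hist) = 1 then 1 / 2 else 100 * (K : ℝ) ^ 2 / n) *
      (((allEdges n \ selEdges n A hist).powersetCard K).filter
        fun F => (F ∩ freshLow (presented hist)).Nonempty).card := by
  set P := presented hist with hPd
  set B := selEdges n A hist with hBd
  set M := allEdges n \ B with hM
  set G := freshLow P with hGd
  have hBP : B ⊆ P := selEdges_subset_presented A hist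
  have hG : G ⊆ M := freshLow_subset hBP
  have hKn : K ≤ n := by nlinarith [Nat.one_le_pow 2 K hK]
  have hMn : n ^ 2 ≤ 4 * M.card := by
    have h1 : M.card + B.card = (allEdges n).card :=
      Finset.card_sdiff_add_card_eq_card (hBP.trans hP)
    have h2 := two_mul_card_allEdges n
    obtain ⟨m, rfl⟩ : ∃ m, n = m + 1 := ⟨n - 1, by omega⟩
    simp only [Nat.add_sub_cancel] at h2
    have h3 : (m + 1) / 100 ≤ m := by omega
    nlinarith
  have hM0 : 0 < M.card := by nlinarith
  have hKM : K ≤ M.card := by nlinarith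
  have hn0 : (0 : ℝ) < n := by exact_mod_cast (by omega : 0 < n)
  have hMn' : (n : ℝ) ^ 2 ≤ 4 * M.card := by exact_mod_cast hMn
  have hMpos : (0 : ℝ) < M.card := by exact_mod_cast hM0
  have hg : n ≤ G.card + 2 := le_card_freshLow hd
  have hμ : meanHits K M G ≤ 8 * (K : ℝ) ^ 2 / n := by
    have h1 : G.card ≤ 2 * K * n :=
      (card_freshLow_le P).trans (Nat.mul_le_mul_right n hd2)
    have h1' : (G.card : ℝ) ≤ 2 * K * n := by exact_mod_cast h1
    rw [meanHits, div_le_div_iff₀ hMpos hn0]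
    calc (G.card : ℝ) * K * n ≤ 2 * K * n * K * n := by gcongr
      _ = 2 * K ^ 2 * n ^ 2 := by ring
      _ ≤ 2 * K ^ 2 * (4 * M.card) := by gcongr
      _ = 8 * K ^ 2 * M.card := by ring
  have hμ1 : meanHits K M G ≤ 1 := by
    refine hμ.trans (div_le_one_of_le₀ ?_ hn0.le)
    have : 8 * K ^ 2 ≤ n := by nlinarith [Nat.pow_le_pow_right hK (show 2 ≤ 3 by norm_num)]
    exact_mod_cast this
  split_ifs with h1
  · obtain ⟨v, hv⟩ := low_nonempty hd
    have hv1 := mem_low.1 hv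
    have hc := card_completing_le (B := B) (v := v)
      (fun e he => (Finset.mem_filter.1 (hP (hBP he))).2)
      ((card_edgesAt_mono hBP v).trans hv1) hB
    have hI : 4 * ((completing B v).card : ℝ) ≤ 1 * G.card := by
      rw [one_mul]
      exact_mod_cast (by omega : 4 * (completing B v).card ≤ G.card)
    refine le_trans ?_ (card_filter_inter_nonempty_le_mul hKM hM0 hG hμ1 zero_le_one hI)
    refine Nat.cast_le.2 (Finset.card_le_card fun F hF => ?_)
    obtain ⟨h2, h3⟩ := hW F hF
    exact Finset.mem_filter.2 ⟨h2, completing_of_mem_winning (by omega) hd hv1 h3⟩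
  · have hI : 4 * ((innerLow P).card : ℝ) ≤ 100 * (K : ℝ) ^ 2 / n * G.card := by
      have h2 := (card_innerLow_le P).trans (Nat.mul_le_mul hd2 hd2)
      have h2' : ((innerLow P).card : ℝ) ≤ 4 * K ^ 2 := by
        have : (innerLow P).card ≤ 4 * K ^ 2 := by linarith
        exact_mod_cast this
      have h3 : (n : ℝ) ≤ 2 * G.card := by exact_mod_cast (by omega : n ≤ 2 * G.card)
      rw [div_mul_eq_mul_div, le_div_iff₀ hn0]
      calc 4 * ((innerLow P).card : ℝ) * n ≤ 4 * (4 * K ^ 2) * (2 * G.card) := by gcongr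
        _ = 32 * K ^ 2 * G.card := by ring
        _ ≤ 100 * K ^ 2 * G.card := by gcongr; norm_num
    have h4 := card_filter_inter_nonempty_le_mul hKM hM0 hG hμ1 (by positivity) hI
    have h5 := card_filter_two_le_le_mul hKM hM0 hG hμ1
    have h6 : W ⊆ (M.powersetCard K).filter (fun F => 2 ≤ (F ∩ G).card) ∪
        (M.powersetCard K).filter fun F => (F ∩ innerLow P).Nonempty := by
      intro F hF
      obtain ⟨h2, h3⟩ := hW F hF
      have hFE : F ⊆ allEdges n :=
        (Finset.mem_powersetCard.1 h2).1.trans Finset.sdiff_subset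
      rcases two_le_or_inner hFE (by omega : 2 ≤ deficiency P)
        (deficiency_eq_zero_of_mem_winning h3) with h | h
      · exact Finset.mem_union_left _ (Finset.mem_filter.2 ⟨h2, h⟩)
      · exact Finset.mem_union_right _ (Finset.mem_filter.2 ⟨h2, h⟩)
    have h7 := (Nat.cast_le (α := ℝ)).2 ((Finset.card_le_card h6).trans (Finset.card_union_le _ _))
    rw [Nat.cast_add] at h7
    have h8 : 8 * (K : ℝ) ^ 2 / n ≤ 100 * (K : ℝ) ^ 2 / n / 2 := by
      rw [div_div, mul_comm (n : ℝ), ← div_div, div_le_div_iff_of_pos_right hn0]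
      nlinarith [sq_nonneg (K : ℝ)]
    have h9 := mul_le_mul_of_nonneg_right (hμ.trans h8)
      (Nat.cast_nonneg (α := ℝ) ((M.powersetCard K).filter fun F => (F ∩ G).Nonempty).card)
    linarith

lemma sum_potential_le (hn : 1000 ≤ n) (hK : 1 ≤ K) (hK3 : 1000 * K ^ 3 ≤ n)
    (hsel : ∀ t, ∀ hist ∈ (traj n K A t).support, ∀ s, IsTauTwo n hist s →
      (selEdges n A (firstRounds s hist)).card ≤ n + n / 100)
    {t : ℕ} {hist : List (Finset (Sym2 (Fin n)))} (hs : hist ∈ (traj n K A t).support)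
    (hd : deficiency (presented hist) ≠ 0) :
    ∑ F ∈ (allEdges n \ selEdges n A hist).powersetCard K, potential K A (F :: hist) ≤
      ((allEdges n \ selEdges n A hist).powersetCard K).card * potential K A hist := by
  classical
  obtain ⟨hlen, hP⟩ := length_eq_and_presented_subset hs
  set M := allEdges n \ selEdges n A hist with hM
  set r : ℝ := 100 * (K : ℝ) ^ 2 / n with hr
  have hr0 : 0 ≤ r := by positivity
  have hmono : ∀ F, F :: hist ∉ winning A → potential K A (F :: hist) ≤ potential K A hist := by
    intro F hF
    have h2 : deficiency (presented (F :: hist)) ≤ deficiency (presented hist) :=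
      deficiency_anti Finset.subset_union_right
    rw [potential_of_ne hd, potential, if_neg hF]
    split_ifs with h
    · positivity
    · gcongr
  set W := (M.powersetCard K).filter fun F => F :: hist ∈ winning A with hW
  rcases W.eq_empty_or_nonempty with hWe | ⟨F₀, hF₀⟩
  · rw [← nsmul_eq_mul]
    refine Finset.sum_le_card_nsmul _ _ _ fun F hF => hmono F fun hw => ?_
    exact Finset.notMem_empty F (hWe ▸ Finset.mem_filter.2 ⟨hF, hw⟩)
  obtain ⟨hF₀, hw₀⟩ := Finset.mem_filter.1 hF₀
  have hz := deficiency_eq_zero_of_mem_winning hw₀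
  have hd2 : deficiency (presented hist) ≤ 2 * K := by
    obtain ⟨h1, h2⟩ := Finset.mem_powersetCard.1 hF₀
    refine (deficiency_le_two_mul (h1.trans Finset.sdiff_subset) hz).trans ?_
    rw [← h2]
    exact Nat.mul_le_mul_left 2 (Finset.card_le_card Finset.inter_subset_left)
  have hB : (selEdges n A hist).card ≤ n + n / 100 := by
    have h1 := hsel _ _ (cons_mem_support hs hF₀) _ (isTauTwo_cons_length hd hz)
    rw [firstRounds_of_length_le (by simp)] at h1
    exact (Finset.card_le_card (selEdges_subset_cons A F₀ hist)).trans h1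
  have hcount := card_winning_le hn hK hK3 hP hd hd2 hB (W := W)
    fun F hF => Finset.mem_filter.1 hF
  set c : ℝ := if deficiency (presented hist) = 1 then 1 / 2 else r with hc
  have hpt : ∀ F ∈ M.powersetCard K, potential K A (F :: hist) ≤ potential K A hist -
      c * (if (F ∩ freshLow (presented hist)).Nonempty then 1 else 0) +
      (if F :: hist ∈ winning A then 1 else 0) := by
    intro F _
    have hcb : c ≤ potential K A hist := by
      have h1 : (1 : ℝ) ≤ deficiency (presented hist) := by
        exact_mod_cast Nat.one_le_iff_ne_zero.2 hd
      have h2 : (1 : ℝ) ≤ 2 * K := by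
        have : (1 : ℝ) ≤ K := by exact_mod_cast hK
        linarith
      have h3 := mul_le_mul_of_nonneg_left (le_min h1 h2) hr0
      rw [potential_of_ne hd, hc]
      split_ifs <;> linarith
    by_cases hw : F :: hist ∈ winning A
    · have h1 : potential K A (F :: hist) = 1 := by rw [potential, if_pos hw]
      have h0 : 0 ≤ c := by rw [hc]; split_ifs <;> positivity
      rw [h1, if_pos hw]
      split_ifs <;> linarith
    rw [if_neg hw]
    split_ifs with hq
    · have hlt := deficiency_union_lt hq
      rw [← presented_cons] at hlt
      by_cases hz' : deficiency (presented (F :: hist)) = 0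
      · rw [potential, if_neg hw, if_pos hz']
        linarith
      · have hne : deficiency (presented hist) ≠ 1 := by omega
        rw [hc, if_neg hne, potential_of_ne hz', potential_of_ne hd]
        have hd2' : (deficiency (presented hist) : ℝ) ≤ 2 * K := by exact_mod_cast hd2
        have hlt' : (deficiency (presented (F :: hist)) : ℝ) + 1 ≤ deficiency (presented hist) := by
          exact_mod_cast hlt
        rw [min_eq_left hd2', min_eq_left (by linarith)]
        have := mul_le_mul_of_nonneg_left hlt' hr0
        linarith
    · have := hmono F hw
      linarith
  refine (Finset.sum_le_sum hpt).trans ?_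
  rw [Finset.sum_add_distrib, Finset.sum_sub_distrib, ← Finset.mul_sum, Finset.sum_boole,
    Finset.sum_boole, Finset.sum_const, nsmul_eq_mul]
  linarith

/-- With few choices, the last step towards the hitting time rarely completes a Hamilton cycle. -/
lemma probability_le_of_few (hn : 1000 ≤ n) (hK : 1 ≤ K) (hK3 : 1000 * K ^ 3 ≤ n)
    (hsel : ∀ t, ∀ hist ∈ (traj n K A t).support, ∀ s, IsTauTwo n hist s →
      (selEdges n A (firstRounds s hist)).card ≤ n + n / 100) (L : ℕ) :
    ((traj n K A L).toOuterMeasure (winning A)).toReal ≤ 3 / 4 := by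
  have hnil : potential K A [] ≤ 3 / 4 := by
    have hd : deficiency (presented ([] : List (Finset (Sym2 (Fin n))))) ≠ 0 := by
      simp [deficiency, edgesAt]
      omega
    have hn0 : (0 : ℝ) < n := by exact_mod_cast (by omega : 0 < n)
    have hK3' : 1000 * (K : ℝ) ^ 3 ≤ n := by exact_mod_cast hK3
    rw [potential_of_ne hd]
    have h1 := mul_le_mul_of_nonneg_left
      (min_le_right (deficiency (presented ([] : List (Finset (Sym2 (Fin n))))) : ℝ) (2 * K))
      (by positivity : (0 : ℝ) ≤ 100 * (K : ℝ) ^ 2 / n)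
    have h2 : 100 * (K : ℝ) ^ 2 / n * (2 * K) ≤ 1 / 4 := by
      rw [div_mul_eq_mul_div, div_le_iff₀ hn0]
      nlinarith
    linarith
  refine (toReal_toOuterMeasure_le (potential K A) potential_nonneg _ ?_ ?_ ?_ L).trans hnil
  · intro t hist hs
    by_cases hd : deficiency (presented hist) = 0
    · rw [← nsmul_eq_mul]
      exact Finset.sum_le_card_nsmul _ _ _ fun F _ => potential_cons_le_of_eq F hd
    · exact sum_potential_le hn hK hK3 hsel hs hd
  · intro t hist _ hlt
    by_cases hd : deficiency (presented hist) = 0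
    · exact potential_cons_le_of_eq _ hd
    · have h1 := Finset.card_le_card (freshLow_subset (selEdges_subset_presented A hist))
      have h2 := le_card_freshLow hd
      have h3 : 2 * K ≤ n := by nlinarith [Nat.one_le_pow 2 K hK]
      omega
  · intro t hist _ hw
    rw [potential, if_pos hw]

end FewChoices

end KChoiceAdaptive

/-- Suppose `1 ≤ K n` and `n − K n = Ω(n)`, and fix `ε < 10⁻⁹`.
Then for every online algorithm for the `K`-choice process that (almost surely) selects
at most `(1 + ε)·n` edges during the first `τ₂` rounds, the probability that its graph
at time `τ₂` is Hamiltonian is bounded away from `1`: there is `δ > 0` such that for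
all large `n` (and every horizon `L`) the probability that `τ₂` occurs within `L`
rounds and the graph at time `τ₂` is Hamiltonian is at most `1 − δ`. -/
theorem no_hitting_time_version
    (K : ℕ → ℕ) (hK1 : ∀ n, 1 ≤ K n)
    (hKn : ∃ c : ℝ, 0 < c ∧ ∀ᶠ n : ℕ in atTop, c * n ≤ (n : ℝ) - K n)
    (ε : ℝ) (hε : ε < 1 / 10 ^ 9)
    (A : (n : ℕ) → Alg n)
    (hsel : ∀ n L hist, hist ∈ (traj n (K n) (A n) L).support →
      ∀ t, IsTauTwo n hist t →
        ((selEdges n (A n) (firstRounds t hist)).card : ℝ) ≤ (1 + ε) * n) :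
    ∃ δ > (0 : ℝ), ∀ᶠ n : ℕ in atTop, ∀ L : ℕ,
      ((traj n (K n) (A n) L).toOuterMeasure
        {hist | ∃ t, IsTauTwo n hist t ∧
          (SimpleGraph.fromEdgeSet
            (↑(selEdges n (A n) (firstRounds t hist)) :
              Set (Sym2 (Fin n)))).IsHamiltonian}).toReal ≤ 1 - δ := by
  refine ⟨1 / 4, by norm_num, ?_⟩
  filter_upwards [eventually_ge_atTop (10 ^ 31)] with n hn L
  refine le_trans (b := (3 / 4 : ℝ)) ?_ (by norm_num)
  have hn' : 1000 ≤ n := le_trans (by norm_num) hn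
  by_cases hK3 : 1000 * K n ^ 3 ≤ n
  · refine probability_le_of_few hn' (hK1 n) hK3 (fun t hist hs s h => ?_) L
    have h1 := hsel n t hist hs s h
    have h2 : (100 * (selEdges n (A n) (firstRounds s hist)).card : ℝ) ≤ 101 * n := by
      have h3 : (0 : ℝ) ≤ n := Nat.cast_nonneg n
      nlinarith
    have h3 : 100 * (selEdges n (A n) (firstRounds s hist)).card ≤ 101 * n := by exact_mod_cast h2
    omega
  · exact (probability_le_decay (le_trans (by norm_num) hn) L).trans
      (decay_bound hn (not_le.1 hK3))
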